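/- Let p, q be even positive integers. Every smooth quasi-periodic solution of y_tt - y_xx = (y_x)^p + (y_t)^q on the circle x ∈ T is constant. -/

import Mathlib

noncomputable section
open Real

/-- time derivative -/
def dt (y : ℝ → ℝ → ℝ) (t x : ℝ) : ℝ := deriv (fun s => y s x) t
/-- second time derivative -/
def dtt (y : ℝ → ℝ → ℝ) (t x : ℝ) : ℝ := deriv (fun s => deriv (fun s' => y s' x) s) t
/-- space derivative -/
def dx (y : ℝ → ℝ → ℝ) (t x : ℝ) : ℝ := deriv (fun z => y t z) x
/-- second space derivative -/
def dxx (y : ℝ → ℝ → ℝ) (t x : ℝ) : ℝ := deriv (fun z => deriv (fun z' => y t z') z) x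

/-- `y(t,x)` is quasi-periodic: `y(t,x) = Y(ωt,x)` with `Y` smooth on `𝕋ⁿ × 𝕋`
(2π-periodic in every variable) and `ω ∈ ℝⁿ` rationally independent. -/
def QuasiPeriodic (y : ℝ → ℝ → ℝ) : Prop :=
  ∃ (n : ℕ) (Y : (Fin n → ℝ) → ℝ → ℝ) (ω : Fin n → ℝ),
    0 < n ∧
    ContDiff ℝ (⊤ : ℕ∞) (fun p : (Fin n → ℝ) × ℝ => Y p.1 p.2) ∧
    (∀ θ x i, Y (Function.update θ i (θ i + 2 * π)) x = Y θ x) ∧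
    (∀ θ x, Y θ (x + 2 * π) = Y θ x) ∧
    (∀ k : Fin n → ℤ, (∑ i, (k i : ℝ) * ω i) = 0 → k = 0) ∧
    (∀ t x, y t x = Y (fun i => ω i * t) x)

open MeasureTheory Set Filter Topology

section PartialDerivatives

variable {y : ℝ → ℝ → ℝ}

theorem hasDerivAt_left_fderiv (hy : ContDiff ℝ (⊤ : ℕ∞) (fun u : ℝ × ℝ => y u.1 u.2)) (t x : ℝ) :
    HasDerivAt (fun s => y s x) (fderiv ℝ (fun u : ℝ × ℝ => y u.1 u.2) (t, x) (1, 0)) t := by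
  have h := (hy.differentiable (by simp) (t, x)).hasFDerivAt
  exact h.comp_hasDerivAt t ((hasDerivAt_id t).prodMk (hasDerivAt_const t x))

theorem hasDerivAt_right_fderiv (hy : ContDiff ℝ (⊤ : ℕ∞) (fun u : ℝ × ℝ => y u.1 u.2)) (t x : ℝ) :
    HasDerivAt (fun z => y t z) (fderiv ℝ (fun u : ℝ × ℝ => y u.1 u.2) (t, x) (0, 1)) x := by
  have h := (hy.differentiable (by simp) (t, x)).hasFDerivAt
  exact h.comp_hasDerivAt x ((hasDerivAt_const x t).prodMk (hasDerivAt_id x))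

theorem hasDerivAt_dt (hy : ContDiff ℝ (⊤ : ℕ∞) (fun u : ℝ × ℝ => y u.1 u.2)) (t x : ℝ) :
    HasDerivAt (fun s => y s x) (dt y t x) t :=
  (hasDerivAt_left_fderiv hy t x).differentiableAt.hasDerivAt

theorem hasDerivAt_dx (hy : ContDiff ℝ (⊤ : ℕ∞) (fun u : ℝ × ℝ => y u.1 u.2)) (t x : ℝ) :
    HasDerivAt (fun z => y t z) (dx y t x) x :=
  (hasDerivAt_right_fderiv hy t x).differentiableAt.hasDerivAt

theorem contDiff_dt (hy : ContDiff ℝ (⊤ : ℕ∞) (fun u : ℝ × ℝ => y u.1 u.2)) :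
    ContDiff ℝ (⊤ : ℕ∞) (fun u : ℝ × ℝ => dt y u.1 u.2) := by
  have h : (fun u : ℝ × ℝ => dt y u.1 u.2) =
      fun u => fderiv ℝ (fun u : ℝ × ℝ => y u.1 u.2) u (1, 0) :=
    funext fun u => (hasDerivAt_left_fderiv hy u.1 u.2).deriv
  rw [h]
  exact (hy.fderiv_right (by simp)).clm_apply contDiff_const

theorem contDiff_dx (hy : ContDiff ℝ (⊤ : ℕ∞) (fun u : ℝ × ℝ => y u.1 u.2)) :
    ContDiff ℝ (⊤ : ℕ∞) (fun u : ℝ × ℝ => dx y u.1 u.2) := by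
  have h : (fun u : ℝ × ℝ => dx y u.1 u.2) =
      fun u => fderiv ℝ (fun u : ℝ × ℝ => y u.1 u.2) u (0, 1) :=
    funext fun u => (hasDerivAt_right_fderiv hy u.1 u.2).deriv
  rw [h]
  exact (hy.fderiv_right (by simp)).clm_apply contDiff_const

theorem ContDiff.continuous_slice (hy : ContDiff ℝ (⊤ : ℕ∞) (fun u : ℝ × ℝ => y u.1 u.2))
    (t : ℝ) : Continuous (y t) :=
  hy.continuous.comp (by fun_prop : Continuous fun x : ℝ => (t, x))

theorem hasDerivAt_integral_dt (hy : ContDiff ℝ (⊤ : ℕ∞) (fun u : ℝ × ℝ => y u.1 u.2))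
    (a b t : ℝ) :
    HasDerivAt (fun s => ∫ x in a..b, y s x) (∫ x in a..b, dt y t x) t := by
  obtain ⟨C, hC⟩ := ((isCompact_Icc (a := t - 1) (b := t + 1)).prod
    (isCompact_uIcc (a := a) (b := b))).exists_bound_of_continuousOn
      (contDiff_dt hy).continuous.continuousOn
  refine (intervalIntegral.hasDerivAt_integral_of_dominated_loc_of_deriv_le
    (F := fun s x => y s x) (F' := fun s x => dt y s x)
    (Icc_mem_nhds (by linarith : t - 1 < t) (by linarith : t < t + 1))
    (Eventually.of_forall fun s => (hy.continuous_slice s).aestronglyMeasurable)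
    ((hy.continuous_slice t).intervalIntegrable a b)
    ((contDiff_dt hy).continuous_slice t).aestronglyMeasurable
    (bound := fun _ => C) (ae_of_all _ fun x hx s hs => ?_) intervalIntegrable_const
    (ae_of_all _ fun x _ s _ => hasDerivAt_dt hy s x)).2
  exact hC (s, x) ⟨hs, uIoc_subset_uIcc hx⟩

end PartialDerivatives

theorem eq_zero_of_bounded_of_deriv_nonneg {A B D : ℝ → ℝ} {M : ℝ}
    (hA : ∀ t, HasDerivAt A (B t) t) (hB : ∀ t, HasDerivAt B (D t) t)
    (hD : ∀ t, 0 ≤ D t) (hM : ∀ t, |A t| ≤ M) (t : ℝ) : B t = 0 := by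
  have hmono : Monotone B := monotone_of_hasDerivAt_nonneg hB hD
  have hconv : ConvexOn ℝ univ A := by
    refine Monotone.convexOn_univ_of_deriv (fun t => (hA t).differentiableAt) ?_
    rwa [funext fun t => (hA t).deriv]
  have key : ∀ s, A t + B t * (s - t) ≤ A s := by
    intro s
    rcases lt_trichotomy t s with h | rfl | h
    · have := hconv.le_slope_of_hasDerivAt (mem_univ t) (mem_univ s) h (hA t)
      rw [slope_def_field, le_div_iff₀ (by linarith)] at this
      linarith
    · simp
    · have := hconv.slope_le_of_hasDerivAt (mem_univ s) (mem_univ t) h (hA t)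
      rw [slope_def_field, div_le_iff₀ (by linarith)] at this
      linarith
  by_contra hne
  have h := key (t + (2 * M + 1) / B t)
  have h₁ : B t * (t + (2 * M + 1) / B t - t) = 2 * M + 1 := by field_simp; ring
  rw [h₁] at h
  linarith [abs_le.1 (hM t), abs_le.1 (hM (t + (2 * M + 1) / B t))]

/-- A function periodic in each coordinate is determined by its values on a fundamental box. -/
theorem apply_toIcoMod_eq_of_periodic_update {ι α : Type*} [Fintype ι] [DecidableEq ι]
    {F : (ι → ℝ) → α} {T : ℝ} (hT : 0 < T)
    (hF : ∀ θ i, F (Function.update θ i (θ i + T)) = F θ) (θ : ι → ℝ) :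
    F (fun i => toIcoMod hT 0 (θ i)) = F θ := by
  have hstep : ∀ θ i, F (Function.update θ i (toIcoMod hT 0 (θ i))) = F θ := by
    intro θ i
    have hper : Function.Periodic (fun u => F (Function.update θ i u)) T := by
      intro u
      simpa using hF (Function.update θ i u) i
    have h := hper.sub_zsmul_eq (x := θ i) (toIcoDiv hT 0 (θ i))
    simpa using h
  have h : ∀ s : Finset ι, F (fun i => if i ∈ s then toIcoMod hT 0 (θ i) else θ i) = F θ := by
    intro s
    induction s using Finset.induction_on with
    | empty => simp
    | insert j s hj ih =>
      rw [← ih, ← hstep (fun i => if i ∈ s then toIcoMod hT 0 (θ i) else θ i) j]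
      congr 1
      ext i
      by_cases hij : i = j
      · subst hij; simp [hj]
      · simp [hij]
  simpa using h Finset.univ

theorem QuasiPeriodic.exists_bound {y : ℝ → ℝ → ℝ} (hy : QuasiPeriodic y) (a b : ℝ) :
    ∃ C, ∀ t, ∀ x ∈ uIcc a b, |y t x| ≤ C := by
  obtain ⟨n, Y, ω, -, hY, hθ, -, -, hyY⟩ := hy
  obtain ⟨C, hC⟩ := ((isCompact_univ_pi fun _ : Fin n =>
    isCompact_Icc (a := (0 : ℝ)) (b := 2 * π)).prod
      (isCompact_uIcc (a := a) (b := b))).exists_bound_of_continuousOn hY.continuous.continuousOn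
  refine ⟨C, fun t x hx => ?_⟩
  rw [hyY, ← apply_toIcoMod_eq_of_periodic_update (F := fun θ => Y θ x) two_pi_pos
    (fun θ i => hθ θ x i)]
  exact hC (_, x) ⟨fun i _ => Ico_subset_Icc_self (toIcoMod_mem_Ico' two_pi_pos _), hx⟩

theorem QuasiPeriodic.periodic {y : ℝ → ℝ → ℝ} (hy : QuasiPeriodic y) (t : ℝ) :
    Function.Periodic (y t) (2 * π) := by
  obtain ⟨n, Y, ω, -, -, -, hx, -, hyY⟩ := hy
  intro x
  rw [hyY, hyY, hx]

/- STATEMENT 6: even p, q > 0; any smooth quasi-periodic solution of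
   y_tt - y_xx = (y_x)^p + (y_t)^q on the circle is constant. -/
theorem no_qp_solutions_yx_yt_pow_even
    (p q : ℕ) (hp : Even p) (hp0 : 0 < p) (hq : Even q) (hq0 : 0 < q)
    (y : ℝ → ℝ → ℝ)
    (hy : ContDiff ℝ (⊤ : ℕ∞) (fun u : ℝ × ℝ => y u.1 u.2))
    (hqp : QuasiPeriodic y)
    (hpde : ∀ t x, dtt y t x - dxx y t x = (dx y t x) ^ p + (dt y t x) ^ q) :
    ∃ C : ℝ, ∀ t x, y t x = C := by
  have hyt := contDiff_dt hy
  have hyx := contDiff_dx hy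
  have hdx_per : ∀ t, Function.Periodic (dx y t) (2 * π) := by
    intro t x
    change deriv (y t) (x + 2 * π) = deriv (y t) x
    rw [← deriv_comp_add_const, funext (hqp.periodic t)]
  have hnonneg : ∀ t x, 0 ≤ (dx y t x) ^ p + (dt y t x) ^ q := fun t x =>
    add_nonneg (hp.pow_nonneg _) (hq.pow_nonneg _)
  have hcont : ∀ t, Continuous fun x => (dx y t x) ^ p + (dt y t x) ^ q := fun t =>
    ((hyx.continuous_slice t).pow p).add ((hyt.continuous_slice t).pow q)
  have hint : ∀ a t, ∫ x in a..(a + 2 * π), dt (dt y) t x =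
      ∫ x in a..(a + 2 * π), ((dx y t x) ^ p + (dt y t x) ^ q) := by
    intro a t
    have hzero : ∫ x in a..(a + 2 * π), dx (dx y) t x = 0 := by
      rw [intervalIntegral.integral_eq_sub_of_hasDerivAt
        (fun x _ => hasDerivAt_dx hyx t x)
        (((contDiff_dx hyx).continuous_slice t).intervalIntegrable _ _), hdx_per t a, sub_self]
    rw [← intervalIntegral.integral_congr fun x _ => hpde t x]
    change _ = ∫ x in a..(a + 2 * π), (dt (dt y) t x - dx (dx y) t x)
    rw [intervalIntegral.integral_sub
      (((contDiff_dt hyt).continuous_slice t).intervalIntegrable _ _)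
      (((contDiff_dx hyx).continuous_slice t).intervalIntegrable _ _), hzero, sub_zero]
  have hvanish : ∀ t a, (dx y t a) ^ p + (dt y t a) ^ q = 0 := by
    intro t a
    have hle : a < a + 2 * π := by linarith [two_pi_pos]
    obtain ⟨C, hC⟩ := hqp.exists_bound a (a + 2 * π)
    have hB := eq_zero_of_bounded_of_deriv_nonneg
      (hasDerivAt_integral_dt hy a (a + 2 * π)) (hasDerivAt_integral_dt hyt a (a + 2 * π))
      (fun s => by
        rw [hint]
        exact intervalIntegral.integral_nonneg hle.le fun x _ => hnonneg s x)
      (M := C * |a + 2 * π - a|)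
      (fun s => by
        rw [← Real.norm_eq_abs]
        exact intervalIntegral.norm_integral_le_of_norm_le_const
          fun x hx => hC s x (uIoc_subset_uIcc hx))
    have hD := hasDerivAt_integral_dt hyt a (a + 2 * π) t
    rw [funext hB] at hD
    have h := hD.unique (hasDerivAt_const t 0)
    rw [hint] at h
    by_contra hne
    exact (intervalIntegral.integral_pos hle (hcont t).continuousOn (fun x _ => hnonneg t x)
      ⟨a, left_mem_Icc.2 hle.le, (hnonneg t a).lt_of_ne' hne⟩).ne' h
  have hvan : ∀ t x, dx y t x = 0 ∧ dt y t x = 0 := by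
    intro t x
    obtain ⟨h₁, h₂⟩ := (add_eq_zero_iff_of_nonneg (hp.pow_nonneg _) (hq.pow_nonneg _)).1
      (hvanish t x)
    exact ⟨eq_zero_of_pow_eq_zero h₁, eq_zero_of_pow_eq_zero h₂⟩
  refine ⟨y 0 0, fun t x => ?_⟩
  rw [is_const_of_deriv_eq_zero (fun z => (hasDerivAt_dx hy t z).differentiableAt)
    (fun z => (hvan t z).1) x 0]
  exact is_const_of_deriv_eq_zero (f := fun s => y s 0)
    (fun s => (hasDerivAt_dt hy s 0).differentiableAt) (fun s => (hvan s 0).2) t 0
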